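/- For every nonzero polynomial f ∈ A, D(η·f) ≠ 0. -/

import Mathlib

open MvPolynomial
open scoped Fin.NatCast

noncomputable section

abbrev A : Type := MvPolynomial (Fin 27) ℂ

/-- the variable `x_i` (1-based indexing). -/
def xv (i : ℕ) : A := X ((i - 1 : ℕ) : Fin 27)

/-- the partial derivative `∂_i` (1-based indexing) as a linear operator. -/
def pdE (i : Fin 27) : Module.End ℂ A := (pderiv i).toLinearMap

/-- the operator `x_a ∂_b` (1-based indexing). -/
def md (a b : ℕ) : Module.End ℂ A :=
  (LinearMap.mulLeft ℂ (xv a)) ∘ₗ pdE ((b - 1 : ℕ) : Fin 27)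

/-- the actions `e_1, …, e_6` of the simple positive root vectors of `E₆`. -/
def eOp : ℕ → Module.End ℂ A
  | 1 => -md 1 2 + md 11 14 + md 15 17 + md 16 19 + md 18 21 + md 20 23
  | 2 => -md 4 6 - md 5 7 - md 8 10 + md 18 20 + md 21 23 + md 22 24
  | 3 => -md 2 3 + md 9 11 + md 12 15 + md 13 16 + md 21 22 + md 23 24
  | 4 => -md 3 4 - md 7 9 - md 10 12 - md 16 18 - md 19 21 + md 24 25
  | 5 => -md 4 5 - md 6 7 - md 12 13 - md 15 16 - md 17 19 + md 25 26
  | 6 => -md 5 8 - md 7 10 - md 9 12 - md 11 15 - md 14 17 + md 26 27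
  | _ => 0

/-- the actions `f_1, …, f_6` of the simple negative root vectors of `E₆`. -/
def fOp : ℕ → Module.End ℂ A
  | 1 => md 2 1 - md 14 11 - md 17 15 - md 19 16 - md 21 18 - md 23 20
  | 2 => md 6 4 + md 7 5 + md 10 8 - md 20 18 - md 23 21 - md 24 22
  | 3 => md 3 2 - md 11 9 - md 15 12 - md 16 13 - md 22 21 - md 24 23
  | 4 => md 4 3 + md 9 7 + md 12 10 + md 18 16 + md 21 19 - md 25 24
  | 5 => md 5 4 + md 7 6 + md 13 12 + md 16 15 + md 19 17 - md 26 25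
  | 6 => md 8 5 + md 10 7 + md 12 9 + md 15 11 + md 17 14 - md 27 26
  | _ => 0

/-- the involution of `{0,…,26}` fixing `12, 13, 14` (0-based version of ι). -/
def iotaF : Fin 27 → Fin 27 := fun j =>
  if j.val = 12 ∨ j.val = 13 ∨ j.val = 14 then j else ⟨26 - j.val, by omega⟩

/-- the algebra automorphism τ of `A`. -/
def tau : A →ₐ[ℂ] A := rename iotaF

def z1 : A := xv 1 * xv 14 + xv 2 * xv 11 + xv 3 * xv 9 - xv 4 * xv 7 + xv 5 * xv 6
def z2 : A := fOp 6 z1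
def z3 : A := fOp 5 z2
def z4 : A := fOp 4 z3
def z5 : A := fOp 3 z4
def z6 : A := fOp 2 z4
def z7 : A := fOp 3 z6
def z8 : A := fOp 1 z5
def z9 : A := fOp 4 z7
def z10 : A := fOp 1 z7
def z11 : A := -(fOp 5 z9)
def z12 : A := fOp 4 z10
def z13 : A := fOp 3 z12
def z14 : A := -(fOp 6 z11)
def z15 : A := -(fOp 5 z12)

/-- the quadratic polynomials `ζ_1, …, ζ_27` (1-based indexing). -/
def zeta : ℕ → A
  | 1 => z1 | 2 => z2 | 3 => z3 | 4 => z4 | 5 => z5 | 6 => z6 | 7 => z7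
  | 8 => z8 | 9 => z9 | 10 => z10 | 11 => z11 | 12 => z12 | 13 => z13
  | 14 => z14 | 15 => z15
  | 16 => tau z12 | 17 => tau z11 | 18 => tau z10 | 19 => tau z9
  | 20 => tau z8 | 21 => tau z7 | 22 => tau z6 | 23 => tau z5
  | 24 => tau z4 | 25 => tau z3 | 26 => tau z2 | 27 => tau z1
  | _ => 0

/-- the involution ι of `{1,…,27}` fixing `13, 14, 15`. -/
def iotaN (i : ℕ) : ℕ := if i = 13 ∨ i = 14 ∨ i = 15 then i else 28 - i

/-- the signs ε_i. -/
def eps (i : ℕ) : ℂ :=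
  if i = 9 ∨ i = 11 ∨ i = 12 ∨ i = 13 ∨ i = 14 ∨ i = 15 ∨ i = 16 ∨ i = 17 ∨ i = 19
  then -1 else 1

/-- the `E₆`-invariant cubic polynomial η (Dickson's trilinear form). -/
def eta : A := ∑ i ∈ Finset.Icc 1 27, eps i • (xv i * zeta (iotaN i))

lemma pderiv_swap (i j : Fin 27) (p : A) :
    pderiv i (pderiv j p) = pderiv j (pderiv i p) := by
  induction p using MvPolynomial.induction_on with
  | C a => simp
  | add p q hp hq => simp [hp, hq]
  | mul_X p k ih =>
      have h1 : pderiv i ((pderiv j) (X k) : A) = 0 := by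
        rcases eq_or_ne j k with h | h
        · subst h; simp [pderiv_X_self]
        · simp [pderiv_X_of_ne (Ne.symm h)]
      have h2 : pderiv j ((pderiv i) (X k) : A) = 0 := by
        rcases eq_or_ne i k with h | h
        · subst h; simp [pderiv_X_self]
        · simp [pderiv_X_of_ne (Ne.symm h)]
      simp only [pderiv_mul, map_add, ih, h1, h2]
      ring

lemma pdE_comm (i j : Fin 27) : Commute (pdE i) (pdE j) := by
  refine LinearMap.ext fun p => ?_
  simpa [pdE, Module.End.mul_apply] using pderiv_swap i j p

/-- `Im(g)`: the constant-coefficient differential operator obtained from `g` by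
replacing each variable `x_i` by `∂_i`. -/
def Imo (g : A) : Module.End ℂ A :=
  ∑ d ∈ g.support, g.coeff d •
    Finset.univ.noncommProd (fun i : Fin 27 => pdE i ^ d i)
      (fun i _ j _ _ => (pdE_comm i j).pow_pow _ _)

/-- the invariant operator `D = Im(η)`. -/
def Dop : Module.End ℂ A := Imo eta

/-- the Euler operator `D₁`. -/
def D1 : Module.End ℂ A := ∑ i : Fin 27, (LinearMap.mulLeft ℂ (X i : A)) ∘ₗ pdE i

/-- the invariant operator `D₂ = Σ ζ_i · Im(ζ_i)`. -/
def D2 : Module.End ℂ A :=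
  ∑ i ∈ Finset.Icc 1 27, (LinearMap.mulLeft ℂ (zeta i)) ∘ₗ Imo (zeta i)


section Fischer

variable {σ R : Type*} [CommSemiring R]

/-- The factorial `∏ i, (d i)!` of a multi-index. -/
def multiFactorial (d : σ →₀ ℕ) : ℕ := d.prod fun _ n => n.factorial

lemma multiFactorial_pos (d : σ →₀ ℕ) : 0 < multiFactorial d :=
  Finset.prod_pos fun _ _ => Nat.factorial_pos _

lemma multiFactorial_add_single (d : σ →₀ ℕ) (i : σ) :
    multiFactorial (d + Finsupp.single i 1) = (d i + 1) * multiFactorial d := by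
  classical
  have key (e : σ →₀ ℕ) : multiFactorial e =
      (e i).factorial * multiFactorial (e.erase i) :=
    (Finsupp.mul_prod_erase' e i _ fun _ => Nat.factorial_zero).symm
  rw [key, key d, Finsupp.erase_add, Finsupp.erase_single, add_zero]
  simp [Nat.factorial_succ, mul_assoc]

/-- The Fischer pairing on polynomials: monomials are orthogonal and the monomial with exponent
`d` pairs with itself to `d!`. -/
def fischer : MvPolynomial σ R →ₗ[R] MvPolynomial σ R →ₗ[R] R :=
  (basisMonomials σ R).constr R fun d => (multiFactorial d : R) • lcoeff R d

lemma fischer_monomial (d : σ →₀ ℕ) (a : R) (q : MvPolynomial σ R) :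
    fischer (monomial d a) q = a * (multiFactorial d * q.coeff d) := by
  have h : monomial d a = a • basisMonomials σ R d := by simp [smul_monomial]
  rw [h, map_smul, fischer, Module.Basis.constr_basis]
  simp

lemma fischer_eq_sum (p q : MvPolynomial σ R) :
    fischer p q = ∑ d ∈ p.support, p.coeff d * (multiFactorial d * q.coeff d) := by
  conv_lhs => rw [p.as_sum]
  simp only [map_sum, LinearMap.sum_apply, fischer_monomial]

/-- Multiplication by a variable is adjoint to the corresponding partial derivative. -/
lemma fischer_X_mul (i : σ) (p q : MvPolynomial σ R) :
    fischer (X i * p) q = fischer p (pderiv i q) := by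
  induction p using MvPolynomial.induction_on' with
  | monomial d a =>
    rw [mul_comm, X, monomial_mul, mul_one, fischer_monomial, fischer_monomial, coeff_pderiv,
      multiFactorial_add_single]
    push_cast
    ring
  | add p q hp hq => simp [mul_add, hp, hq]

/-- The Fischer pairing is anisotropic on complex polynomials, once one argument is conjugated. -/
lemma eq_zero_of_fischer_conj_self {p : MvPolynomial σ ℂ}
    (h : fischer (map (starRingEnd ℂ) p) p = 0) : p = 0 := by
  have hs : (map (starRingEnd ℂ) p).support = p.support :=
    support_map_of_injective p (starRingEnd ℂ).injective
  have hre : ∑ d ∈ p.support, (multiFactorial d : ℝ) * Complex.normSq (p.coeff d) = 0 := by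
    rw [fischer_eq_sum, hs] at h
    rw [← Complex.ofReal_eq_zero, ← h, Complex.ofReal_sum]
    refine Finset.sum_congr rfl fun d _ => ?_
    rw [coeff_map, Complex.ofReal_mul, Complex.normSq_eq_conj_mul_self]
    push_cast
    ring
  rw [Finset.sum_eq_zero_iff_of_nonneg fun d _ =>
    mul_nonneg (Nat.cast_nonneg _) (Complex.normSq_nonneg _)] at hre
  by_contra hp
  obtain ⟨d, hd⟩ := Finset.nonempty_iff_ne_empty.2 (mt support_eq_empty.1 hp)
  rcases mul_eq_zero.1 (hre d hd) with h0 | h0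
  · exact (multiFactorial_pos d).ne' (by exact_mod_cast h0)
  · exact mem_support_iff.1 hd (Complex.normSq_eq_zero.1 h0)

end Fischer

lemma fischer_X_pow_mul (i : Fin 27) (n : ℕ) (p q : A) :
    fischer (X i ^ n * p) q = fischer p ((pdE i ^ n) q) := by
  induction n generalizing q with
  | zero => simp
  | succ n ih => rw [pow_succ', mul_assoc, fischer_X_mul, ih, pow_succ]; rfl

lemma fischer_prod_X_pow_mul (s : Finset (Fin 27)) (d : Fin 27 → ℕ)
    (comm : (s : Set (Fin 27)).Pairwise (Function.onFun Commute fun i => pdE i ^ d i)) (p q : A) :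
    fischer ((∏ i ∈ s, X i ^ d i) * p) q =
      fischer p (s.noncommProd (fun i => pdE i ^ d i) comm q) := by
  induction s using Finset.induction_on generalizing q with
  | empty => simp
  | insert i s hi ih =>
    rw [Finset.noncommProd_insert_of_notMem' _ _ _ _ hi, Finset.prod_insert hi, mul_assoc,
      fischer_X_pow_mul, ih]
    rfl

/-- Multiplication by `g` is adjoint to `Imo g`. -/
lemma fischer_mul (g p q : A) : fischer (g * p) q = fischer p (Imo g q) := by
  conv_lhs => rw [g.as_sum, Finset.sum_mul]
  simp only [Imo, map_sum, LinearMap.sum_apply, LinearMap.smul_apply, map_smul]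
  refine Finset.sum_congr rfl fun d _ => ?_
  refine Eq.trans ?_ (congrArg (g.coeff d • ·) (fischer_prod_X_pow_mul Finset.univ d _ p q))
  rw [monomial_eq, Finsupp.prod_fintype _ _ (by simp), mul_assoc,
    ← smul_eq_C_mul, map_smul, LinearMap.smul_apply]

/-- Coefficientwise complex conjugation. -/
def conjA : A →+* A := map (starRingEnd ℂ)

lemma conjA_xv (i : ℕ) : conjA (xv i) = xv i := map_X _ _

lemma conjA_md (a b : ℕ) (p : A) : conjA (md a b p) = md a b (conjA p) := by
  change conjA (xv a * pderiv _ p) = xv a * pderiv _ (conjA p)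
  rw [map_mul, conjA_xv, conjA, pderiv_map]

lemma conjA_fOp (k : ℕ) (p : A) : conjA (fOp k p) = fOp k (conjA p) := by
  unfold fOp
  split <;> simp [conjA_md]

lemma conjA_tau (p : A) : conjA (tau p) = tau (conjA p) := map_rename _ _ _

lemma conjA_zeta (i : ℕ) : conjA (zeta i) = zeta i := by
  unfold zeta
  split <;> simp [z15, z14, z13, z12, z11, z10, z9, z8, z7, z6, z5, z4, z3, z2, z1,
    conjA_tau, conjA_fOp, conjA_xv]

lemma conjA_eta : conjA eta = eta := by
  rw [eta, map_sum]
  refine Finset.sum_congr rfl fun i _ => ?_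
  have h : starRingEnd ℂ (eps i) = eps i := by unfold eps; split <;> simp
  rw [smul_eq_C_mul, map_mul, map_mul, conjA_xv, conjA_zeta, conjA, map_C, h]

lemma md_mul (a b : ℕ) (p q : A) : md a b (p * q) = md a b p * q + p * md a b q := by
  change xv a * pderiv _ (p * q) = xv a * pderiv _ p * q + p * (xv a * pderiv _ q)
  rw [pderiv_mul]
  ring

lemma md_xv (a b c : ℕ) :
    md a b (xv c) = if ((c - 1 : ℕ) : Fin 27) = ((b - 1 : ℕ) : Fin 27) then xv a else 0 := by
  change xv a * pderiv _ (X _) = _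
  rw [pderiv_X, Pi.single_apply]
  simp only [mul_ite, mul_one, mul_zero]

lemma z4_eq : z4 = xv 1 * xv 21 + xv 2 * xv 18 + xv 4 * xv 13 - xv 5 * xv 12 + xv 8 * xv 9 := by
  simp [z4, z3, z2, z1, fOp, md_mul, md_xv]
  ring

lemma z9_eq :
    z9 = -(xv 1 * xv 25) - xv 4 * xv 20 - xv 6 * xv 18 + xv 9 * xv 15 - xv 11 * xv 12 := by
  simp [z9, z7, z6, z4_eq, fOp, md_mul, md_xv]
  ring

lemma z14_eq :
    z14 = -(xv 1 * xv 27) - xv 8 * xv 20 - xv 10 * xv 18 + xv 12 * xv 16 - xv 13 * xv 15 := by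
  simp [z14, z11, z9_eq, fOp, md_mul, md_xv]
  ring

/-- The point with coordinates `x₁ = x₁₄ = x₂₇ = 1` and all others zero, where `η` equals `3`. -/
def etaPoint (i : Fin 27) : ℂ := if i = 0 ∨ i = 13 ∨ i = 26 then 1 else 0

lemma eval_etaPoint_eta : eval etaPoint eta = 3 := by
  have hx (i : ℕ) : eval etaPoint (xv i) = etaPoint ((i - 1 : ℕ) : Fin 27) := eval_X _
  have hr (i : ℕ) : eval etaPoint (rename iotaF (xv i)) =
      etaPoint (iotaF ((i - 1 : ℕ) : Fin 27)) := by
    rw [xv, rename_X, eval_X]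
  have hsub : ({1, 14, 27} : Finset ℕ) ⊆ Finset.Icc 1 27 := by decide
  rw [eta, map_sum, ← Finset.sum_subset hsub]
  · simp [zeta, iotaN, eps, z1, z14_eq, tau, hx, hr]
    simp [etaPoint, iotaF, Fin.ext_iff]
    norm_num
  · intro i hi hn
    have : eval etaPoint (xv i) = 0 := by
      rw [hx]
      fin_cases hi <;> simp_all [etaPoint]
    rw [smul_eval, map_mul, this, zero_mul, mul_zero]

lemma eta_ne_zero : eta ≠ 0 := fun h => by
  simpa [h] using eval_etaPoint_eta

/-- `D(η f) ≠ 0` for every nonzero `f`. -/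
theorem stmt14 (f : A) (hf : f ≠ 0) : Dop (eta * f) ≠ 0 := by
  intro h
  refine mul_ne_zero eta_ne_zero hf (eq_zero_of_fischer_conj_self ?_)
  change fischer (conjA (eta * f)) (eta * f) = 0
  rw [conjA.map_mul, conjA_eta, fischer_mul, ← Dop, h, map_zero]

end
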